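/- Let r > 0 and define a(d,n) = (1 + k(d,n))^{−r}. Then there exist constants c > 0 and C > 0 depending only on r such that for all integers d ≥ 2: (i) for 1 ≤ n ≤ d, c ≤ a(d,n) ≤ C; (ii) for d ≤ n ≤ 2^d, c·(ln(1+d/ln n)/ln n)^r ≤ a(d,n) ≤ C·(ln(1+d/ln n)/ln n)^r; (iii) for n ≥ 2^d, c·d^{−r}·n^{−r/d} ≤ a(d,n) ≤ C·d^{−r}·n^{−r/d}. -/

import Mathlib

/-- `C(d,k) = (2k+d)·(k+d−1)!/(k!·d!)`, the dimension of the space of spherical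
polynomials of degree at most `k` on the sphere `S^d`, as a real number. -/
noncomputable def sphC (d k : ℕ) : ℝ :=
  ((2 * k + d : ℕ) : ℝ) * (Nat.factorial (k + d - 1) : ℝ) /
    ((Nat.factorial k : ℝ) * (Nat.factorial d : ℝ))

/-- The approximation numbers `a(d,n) = (1 + k(d,n))^{−r}` of the embedding
`I_d : H^{r,#}(S^d) → L₂(S^d)`, expressed via an index function `kf` with
`kf n = k(d,n)`. -/
noncomputable def aSharp (r : ℝ) (kf : ℕ → ℕ) (n : ℕ) : ℝ :=
  (1 + (kf n : ℝ)) ^ (-r)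

theorem sphC_eq_mul_choose {d : ℕ} (hd : 0 < d) (k : ℕ) :
    sphC d k = (2 * k + d) / (k + d) * ((k + d).choose d : ℝ) := by
  obtain ⟨m, rfl⟩ : ∃ m, d = m + 1 := ⟨d - 1, by omega⟩
  have h := Nat.add_choose_mul_factorial_mul_factorial k (m + 1)
  have hf : (k + (m + 1)).factorial = (k + m + 1) * (k + m).factorial := Nat.factorial_succ (k + m)
  rw [hf] at h
  have h' : ((k + (m + 1)).choose (m + 1) : ℝ) * k.factorial * (m + 1).factorial
      = (k + m + 1) * (k + m).factorial := by exact_mod_cast h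
  have e : k + (m + 1) - 1 = k + m := by omega
  have h1 : (k.factorial : ℝ) ≠ 0 := by positivity
  have h2 : ((m + 1).factorial : ℝ) ≠ 0 := by positivity
  have h3 : (k : ℝ) + (m + 1) ≠ 0 := by positivity
  unfold sphC
  rw [e]
  push_cast
  field_simp
  linear_combination -h'

theorem choose_le_sphC {d : ℕ} (hd : 0 < d) (k : ℕ) : ((k + d).choose d : ℝ) ≤ sphC d k := by
  rw [sphC_eq_mul_choose hd]
  have : (0 : ℝ) < d := by exact_mod_cast hd
  refine le_mul_of_one_le_left (by positivity) ?_
  rw [le_div_iff₀ (by positivity)]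
  linarith [(Nat.cast_nonneg k : (0 : ℝ) ≤ k)]

theorem sphC_le_two_mul_choose {d : ℕ} (hd : 0 < d) (k : ℕ) :
    sphC d k ≤ 2 * ((k + d).choose d : ℝ) := by
  rw [sphC_eq_mul_choose hd]
  have : (0 : ℝ) < d := by exact_mod_cast hd
  gcongr
  rw [div_le_iff₀ (by positivity)]
  linarith

theorem log_choose_le (N j : ℕ) (hj : j ≤ N) {t : ℝ} (ht : 0 < t) :
    Real.log (N.choose j) ≤ N * t - j * Real.log t := by
  have hpos : (0 : ℝ) < N.choose j := by exact_mod_cast Nat.choose_pos hj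
  have h : t ^ j * (N.choose j : ℝ) ≤ (t + 1) ^ N := by
    rw [add_pow]
    simpa using Finset.single_le_sum (f := fun m ↦ t ^ m * 1 ^ (N - m) * (N.choose m : ℝ))
      (fun i _ ↦ by positivity) (Finset.mem_range.2 (Nat.lt_succ_of_le hj))
  have h' := Real.log_le_log (by positivity) h
  rw [Real.log_mul (by positivity) hpos.ne', Real.log_pow, Real.log_pow] at h'
  have h'' : Real.log (t + 1) ≤ t := by
    linarith [Real.log_le_sub_one_of_pos (show 0 < t + 1 by linarith)]
  nlinarith [mul_le_mul_of_nonneg_left h'' (Nat.cast_nonneg N : (0 : ℝ) ≤ N)]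

theorem one_add_div_pow_le_choose (a c : ℕ) {b : ℕ} (hbc : b ≤ c) :
    (1 + (a : ℝ) / c) ^ b ≤ (a + b).choose b := by
  induction b with
  | zero => simp
  | succ b ih =>
    have h : ((a + b + 1).choose (b + 1) : ℝ) = (a + b).choose b * (1 + a / (b + 1)) := by
      have := Nat.add_one_mul_choose_eq (a + b) b
      have h' : ((a : ℝ) + b + 1) * (a + b).choose b = (a + b + 1).choose (b + 1) * (b + 1) := by
        exact_mod_cast this
      field_simp
      linear_combination -h'
    rw [← add_assoc, h, pow_succ]
    have : (b : ℝ) + 1 ≤ c := by exact_mod_cast hbc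
    gcongr
    exact ih (by omega)

theorem mul_log_one_add_div_le_log_choose (a b : ℕ) :
    b * Real.log (1 + a / b) ≤ Real.log ((a + b).choose b) := by
  rw [← Real.log_pow]
  exact Real.log_le_log (by positivity) (one_add_div_pow_le_choose a b le_rfl)

theorem log_le_of_le_sphC {d k n : ℕ} (hd : 0 < d) (hn : 0 < n) (h : (n : ℝ) ≤ sphC d k) :
    Real.log n ≤ Real.log 2 + Real.log ((k + d).choose d) := by
  have hpos : (0 : ℝ) < (k + d).choose d := by exact_mod_cast Nat.choose_pos (by omega)
  rw [← Real.log_mul (by norm_num) hpos.ne']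
  exact Real.log_le_log (by exact_mod_cast hn) (h.trans (sphC_le_two_mul_choose hd k))

theorem rpow_neg_bounds {r K P : ℝ} (hr : 0 < r) (hK : 0 < K) (hP : 0 < P)
    (h₁ : K ≤ 8 * P) (h₂ : P ≤ 54 * K) :
    (8 : ℝ) ^ (-r) * P ^ (-r) ≤ K ^ (-r) ∧ K ^ (-r) ≤ (54 : ℝ) ^ r * P ^ (-r) := by
  constructor
  · rw [← Real.mul_rpow (by norm_num) hP.le]
    exact Real.rpow_le_rpow_of_nonpos hK h₁ (by linarith)
  · have := Real.rpow_le_rpow_of_nonpos hP h₂ (show -r ≤ 0 by linarith)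
    rw [Real.mul_rpow (by norm_num) hK.le, Real.rpow_neg (by norm_num),
      inv_mul_le_iff₀ (by positivity)] at this
    exact this

theorem three_mul_le_of_le_log_two_add {d L k : ℝ} (hL : 0 < L) (hLd : L ≤ d) (hk : 0 ≤ k)
    (h : L ≤ Real.log 2 + (k + d) * (L / (4 * d)) - k * Real.log (L / (4 * d))) :
    3 * L ≤ 16 * ((1 + k) * Real.log (1 + d / L)) := by
  have hd : 0 < d := hL.trans_le hLd
  have hy : 1 ≤ d / L := (one_le_div hL).2 hLd
  set M := Real.log (1 + d / L) with hM
  have hM2 : Real.log 2 ≤ M := Real.log_le_log (by norm_num) (by linarith)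
  have hyM : Real.log (d / L) ≤ M := Real.log_le_log (by positivity) (by linarith)
  have ht : L / (4 * d) ≤ 1 / 4 := by
    rw [div_le_iff₀ (by positivity)]
    linarith
  have hlog : Real.log (L / (4 * d)) = -(2 * Real.log 2 + Real.log (d / L)) := by
    have : L / (4 * d) = ((2 : ℝ) ^ 2 * (d / L))⁻¹ := by
      field_simp
      norm_num
    rw [this, Real.log_inv, Real.log_mul (by norm_num) (by positivity), Real.log_pow]
    norm_num
  have hdt : d * (L / (4 * d)) = L / 4 := by field_simp
  have hk' : k * (L / (4 * d) - Real.log (L / (4 * d))) ≤ k * (4 * M) := by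
    refine mul_le_mul_of_nonneg_left ?_ hk
    linarith [Real.log_two_gt_d9]
  linarith [Real.log_two_gt_d9]

theorem mul_log_one_add_div_le_two_mul {d L j : ℝ} (hd : 0 ≤ d) (hL : 0 < L) (hj : 0 < j)
    (hjL : j ≤ 2 * L) (h : j * Real.log (1 + d / j) ≤ L) :
    j * Real.log (1 + d / L) ≤ 2 * L := by
  have hsq : Real.log (1 + d / L) ≤ 2 * Real.log (1 + d / (2 * L)) := by
    have h2 : 2 * Real.log (1 + d / (2 * L)) = Real.log ((1 + d / (2 * L)) ^ 2) := by
      rw [Real.log_pow]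
      norm_num
    rw [h2]
    refine Real.log_le_log (by positivity) ?_
    have : d / L = 2 * (d / (2 * L)) := by field_simp
    nlinarith [sq_nonneg (d / (2 * L))]
  have hmono : Real.log (1 + d / (2 * L)) ≤ Real.log (1 + d / j) :=
    Real.log_le_log (by positivity) (by gcongr)
  nlinarith

theorem log_one_add_div_log_le {d n : ℕ} (hn : 2 ≤ n) (hdn : d ≤ n) :
    Real.log (1 + d / Real.log n) ≤ 3 * Real.log n := by
  have hn' : (2 : ℝ) ≤ n := by exact_mod_cast hn
  have hdn' : (d : ℝ) ≤ n := by exact_mod_cast hdn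
  have hL : (1 / 2 : ℝ) ≤ Real.log n := by
    linarith [Real.log_two_gt_d9, Real.log_le_log (by norm_num) hn']
  have h3 : 3 * Real.log n = Real.log ((n : ℝ) ^ 3) := by
    rw [Real.log_pow]
    norm_num
  rw [h3]
  refine Real.log_le_log (by positivity) ?_
  have : (d : ℝ) / Real.log n ≤ 2 * n := by
    rw [div_le_iff₀ (by linarith)]
    nlinarith
  nlinarith [pow_nonneg (sub_nonneg.2 hn') 2, pow_nonneg (sub_nonneg.2 hn') 3]

section IndexBounds

variable {d k n : ℕ}

theorem le_one_of_le (hd : 0 < d) (hnd : n ≤ d) (hlt : 0 < k → sphC d (k - 1) < n) : k ≤ 1 := by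
  by_contra! hk
  obtain ⟨j, rfl⟩ : ∃ j, k = j + 2 := ⟨k - 2, by omega⟩
  have h := (choose_le_sphC hd (j + 1)).trans_lt (hlt (by omega))
  have h' : (j + 1 + d).choose d < n := by exact_mod_cast h
  have h2 : (d + 1).choose d ≤ (j + 1 + d).choose d := Nat.choose_le_choose d (by omega)
  rw [Nat.choose_succ_self_right] at h2
  omega

theorem log_le_of_le_sphC_left (hd : 0 < d) (hn : 0 < n) (h : (n : ℝ) ≤ sphC d k) {t : ℝ}
    (ht : 0 < t) : Real.log n ≤ Real.log 2 + (k + d) * t - k * Real.log t := by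
  have h₁ := log_le_of_le_sphC hd hn h
  have h₂ := log_choose_le (k + d) k (by omega) ht
  rw [Nat.choose_symm_add] at h₂
  push_cast at h₂
  linarith

theorem log_le_of_le_sphC_right (hd : 0 < d) (hn : 0 < n) (h : (n : ℝ) ≤ sphC d k) {t : ℝ}
    (ht : 0 < t) : Real.log n ≤ Real.log 2 + (k + d) * t - d * Real.log t := by
  have h₁ := log_le_of_le_sphC hd hn h
  have h₂ := log_choose_le (k + d) d (by omega) ht
  push_cast at h₂
  linarith

theorem log_choose_le_log_of_sphC_lt {j : ℕ} (hd : 0 < d) (h : sphC d j < n) :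
    Real.log ((j + d).choose d) ≤ Real.log n :=
  Real.log_le_log (by exact_mod_cast Nat.choose_pos (by omega))
    ((choose_le_sphC hd j).trans h.le)

theorem le_of_sphC_lt_of_le_two_pow {j : ℕ} (hd : 0 < d) (hn : n ≤ 2 ^ d) (h : sphC d j < n) :
    j ≤ d := by
  by_contra! hj
  have h₁ : ((j + d).choose d : ℝ) < n := (choose_le_sphC hd j).trans_lt h
  have h₂ := one_add_div_pow_le_choose j d le_rfl
  have hn' : (n : ℝ) ≤ 2 ^ d := by exact_mod_cast hn
  have h₃ : (2 : ℝ) ^ d ≤ (1 + (j : ℝ) / d) ^ d := by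
    gcongr
    have : (1 : ℝ) ≤ j / d := by
      rw [one_le_div (by exact_mod_cast hd)]
      exact_mod_cast hj.le
    linarith
  linarith

theorem preasymptotic_index_bounds (hd : 2 ≤ d) (hdn : d ≤ n) (hn : n ≤ 2 ^ d)
    (hle : (n : ℝ) ≤ sphC d k) (hlt : 0 < k → sphC d (k - 1) < n) :
    (1 + k) * Real.log (1 + d / Real.log n) ≤ 8 * Real.log n ∧
      3 * Real.log n ≤ 16 * ((1 + k) * Real.log (1 + d / Real.log n)) := by
  have hd0 : 0 < d := by omega
  have hdR : (0 : ℝ) < d := by exact_mod_cast hd0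
  have hn1 : (1 : ℝ) < n := by exact_mod_cast (by omega : 1 < n)
  have hL : 0 < Real.log n := Real.log_pos hn1
  have hLd : Real.log n ≤ d := by
    have : Real.log n ≤ Real.log ((2 : ℝ) ^ d) :=
      Real.log_le_log (by linarith) (by exact_mod_cast hn)
    rw [Real.log_pow] at this
    nlinarith [Real.log_two_lt_d9]
  have hM : Real.log (1 + d / Real.log n) ≤ 3 * Real.log n :=
    log_one_add_div_log_le (by omega) hdn
  refine ⟨?_, three_mul_le_of_le_log_two_add hL hLd (Nat.cast_nonneg k)
    (log_le_of_le_sphC_left hd0 (by omega) hle (by positivity))⟩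
  obtain rfl | rfl | ⟨j, hj, rfl⟩ : k = 0 ∨ k = 1 ∨ ∃ j, 0 < j ∧ k = j + 1 := by
    rcases k with _ | _ | k
    · simp
    · simp
    · exact .inr (.inr ⟨k + 1, by omega, rfl⟩)
  · push_cast
    linarith
  · push_cast
    linarith
  · have hlt' : sphC d j < n := hlt (by omega)
    have hjd := le_of_sphC_lt_of_le_two_pow hd0 hn hlt'
    have hjR : (0 : ℝ) < j := by exact_mod_cast hj
    have hlog : j * Real.log (1 + d / j) ≤ Real.log n := by
      have h := mul_log_one_add_div_le_log_choose d j
      rw [add_comm d j, Nat.choose_symm_add] at h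
      exact h.trans (log_choose_le_log_of_sphC_lt hd0 hlt')
    have hlog2 : Real.log 2 ≤ Real.log (1 + d / j) := by
      have : (1 : ℝ) ≤ d / j := by
        rw [one_le_div hjR]
        exact_mod_cast hjd
      exact Real.log_le_log (by norm_num) (by linarith)
    have hjL : (j : ℝ) ≤ 2 * Real.log n := by nlinarith [Real.log_two_gt_d9]
    have := mul_log_one_add_div_le_two_mul hdR.le hL hjR hjL hlog
    push_cast
    linarith

theorem asymptotic_index_bounds (hd : 2 ≤ d) (hn : 2 ^ d ≤ n)
    (hle : (n : ℝ) ≤ sphC d k) (hlt : 0 < k → sphC d (k - 1) < n) :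
    1 + (k : ℝ) ≤ d * (n : ℝ) ^ (1 / (d : ℝ)) ∧
      d * (n : ℝ) ^ (1 / (d : ℝ)) ≤ 54 * (1 + (k : ℝ)) := by
  have hd0 : 0 < d := by omega
  have hdR : (2 : ℝ) ≤ d := by exact_mod_cast hd
  have hn0 : 0 < n := (by positivity : 0 < 2 ^ d).trans_le hn
  have hnR : (1 : ℝ) ≤ n := by exact_mod_cast hn0
  constructor
  · rcases k with _ | j
    · have := Real.one_le_rpow hnR (show 0 ≤ 1 / (d : ℝ) by positivity)
      push_cast
      nlinarith
    · have h : (1 + (j : ℝ) / d) ^ d ≤ n := (one_add_div_pow_le_choose j d le_rfl).trans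
        ((choose_le_sphC hd0 j).trans (hlt (by omega)).le)
      have h' : 1 + (j : ℝ) / d ≤ (n : ℝ) ^ (1 / (d : ℝ)) := by
        rw [one_div, Real.le_rpow_inv_iff_of_pos (by positivity) (by positivity) (by positivity),
          Real.rpow_natCast]
        exact h
      have h'' := mul_le_mul_of_nonneg_left h' (show (0 : ℝ) ≤ d by positivity)
      have : (d : ℝ) * (1 + j / d) = d + j := by field_simp
      push_cast
      linarith
  · have hL2 : d * Real.log 2 ≤ Real.log n := by
      rw [← Real.log_pow]
      exact Real.log_le_log (by positivity) (by exact_mod_cast hn)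
    have hkd : (d : ℝ) ≤ 5 * (1 + k) := by
      have h := log_le_of_le_sphC_left hd0 hn0 hle (t := 1 / 4) (by norm_num)
      have h4 : Real.log (1 / 4) = -(2 * Real.log 2) := by
        rw [show (1 / 4 : ℝ) = ((2 : ℝ) ^ 2)⁻¹ by norm_num, Real.log_inv, Real.log_pow]
        norm_num
      rw [h4] at h
      have hk : (0 : ℝ) ≤ k := Nat.cast_nonneg k
      nlinarith [Real.log_two_gt_d9, Real.log_two_lt_d9]
    have hk : (0 : ℝ) < k + d := by positivity
    have h := log_le_of_le_sphC_right hd0 hn0 hle (t := d / (k + d)) (by positivity)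
    have hlog : Real.log (d / (k + d)) = -Real.log ((k + d) / d) := by
      rw [← Real.log_inv, inv_div]
    rw [hlog, mul_div_cancel₀ _ hk.ne'] at h
    have hroot : (n : ℝ) ^ (1 / (d : ℝ)) ≤ Real.exp 2 * ((k + d) / d) := by
      rw [Real.rpow_def_of_pos (by linarith),
        ← Real.exp_log (show 0 < ((k : ℝ) + d) / d by positivity), ← Real.exp_add]
      refine Real.exp_le_exp.2 ?_
      rw [mul_one_div, div_le_iff₀ (by positivity)]
      linarith [Real.log_two_lt_d9]
    have he : Real.exp 2 ≤ 9 := by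
      have h1 := Real.exp_one_lt_d9
      have h2 : Real.exp 2 = Real.exp 1 * Real.exp 1 := by
        rw [← Real.exp_add]
        norm_num
      nlinarith [Real.exp_pos 1]
    calc d * (n : ℝ) ^ (1 / (d : ℝ)) ≤ d * (9 * ((k + d) / d)) := by
          gcongr
          exact hroot.trans (by gcongr)
      _ = 9 * (k + d) := by field_simp
      _ ≤ 54 * (1 + (k : ℝ)) := by linarith

end IndexBounds

/-- Equation (4.10) of Theorem 4.2: preasymptotics and asymptotics of
`a_n(I_d : H^{r,#}(S^d) → L₂(S^d))`, with constants depending only on `r`. -/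
theorem sobolev_sharp_sphere_asymptotics (r : ℝ) (hr : 0 < r) :
    ∃ c C : ℝ, 0 < c ∧ 0 < C ∧
      ∀ d : ℕ, 2 ≤ d → ∀ kf : ℕ → ℕ,
        (∀ n : ℕ, 1 ≤ n →
          (n : ℝ) ≤ sphC d (kf n) ∧ (0 < kf n → sphC d (kf n - 1) < (n : ℝ))) →
        (∀ n : ℕ, 1 ≤ n → n ≤ d →
          c ≤ aSharp r kf n ∧ aSharp r kf n ≤ C) ∧
        (∀ n : ℕ, d ≤ n → n ≤ 2 ^ d →
          c * (Real.log (1 + (d : ℝ) / Real.log n) / Real.log n) ^ r ≤ aSharp r kf n ∧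
          aSharp r kf n ≤ C * (Real.log (1 + (d : ℝ) / Real.log n) / Real.log n) ^ r) ∧
        (∀ n : ℕ, 2 ^ d ≤ n →
          c * (d : ℝ) ^ (-r) * (n : ℝ) ^ (-(r / (d : ℝ))) ≤ aSharp r kf n ∧
          aSharp r kf n ≤ C * (d : ℝ) ^ (-r) * (n : ℝ) ^ (-(r / (d : ℝ)))) := by
  refine ⟨(8 : ℝ) ^ (-r), (54 : ℝ) ^ r, by positivity, by positivity,
    fun d hd kf hkf ↦ ⟨?_, ?_, ?_⟩⟩
  · intro n hn hnd
    have hk : (kf n : ℝ) ≤ 1 := by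
      exact_mod_cast le_one_of_le (by omega) hnd (hkf n hn).2
    have h := rpow_neg_bounds hr (show 0 < 1 + (kf n : ℝ) by positivity) one_pos
      (by linarith) (by linarith [(Nat.cast_nonneg (kf n) : (0 : ℝ) ≤ kf n)])
    rwa [Real.one_rpow, mul_one, mul_one] at h
  · intro n hdn hn
    have hk := hkf n (by omega)
    have hL : 0 < Real.log n := Real.log_pos (by exact_mod_cast (by omega : 1 < n))
    have hM : 0 < Real.log (1 + d / Real.log n) := by
      refine Real.log_pos ?_
      have : 0 < (d : ℝ) / Real.log n := div_pos (by exact_mod_cast (by omega : 0 < d)) hL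
      linarith
    obtain ⟨h₁, h₂⟩ := preasymptotic_index_bounds hd hdn hn hk.1 hk.2
    have hK : 0 < 1 + (kf n : ℝ) := by positivity
    have h := rpow_neg_bounds hr hK (div_pos hL hM)
      (by rwa [← mul_div_assoc, le_div_iff₀ hM])
      (by
        rw [div_le_iff₀ hM]
        nlinarith [mul_pos hK hM])
    rwa [Real.rpow_neg (div_pos hL hM).le, ← Real.inv_rpow (div_pos hL hM).le, inv_div] at h
  · intro n hn
    have hn0 : 0 < n := (by positivity : 0 < 2 ^ d).trans_le hn
    have hk := hkf n hn0
    obtain ⟨h₁, h₂⟩ := asymptotic_index_bounds hd hn hk.1 hk.2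
    have hP : 0 < d * (n : ℝ) ^ (1 / (d : ℝ)) := by
      have : 0 < d := by omega
      positivity
    have h := rpow_neg_bounds hr (show 0 < 1 + (kf n : ℝ) by positivity) hP (by linarith) h₂
    rwa [Real.mul_rpow (by positivity) (by positivity), ← Real.rpow_mul (by positivity),
      show 1 / (d : ℝ) * -r = -(r / d) by ring, ← mul_assoc, ← mul_assoc] at h
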